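/- Assume p = q. If A ⊆ Δ_n^+(𝔩) satisfies P_K(λ_0 − σ(A)) ≠ 0, then there exists a (k, p−k)-shuffle sh of (p, p−1, …, 1) such that A = A(sh). -/

import Mathlib

open Finset

/-- Product over a block `B` of indices of `(λ_i - λ_j)/(j - i)` over pairs `i < j` in `B`. -/
def blockProd (B : Finset ℕ) (lam : ℕ → ℚ) : ℚ :=
  ∏ i ∈ B, ∏ j ∈ B, if i < j then (lam i - lam j) / ((j : ℚ) - (i : ℚ)) else 1

/-- The Weyl dimension polynomial `P_K` for `K = S(U(p) × U(q))`:
`P_K(λ) = ∏_{1≤i<j≤p} (λ_i−λ_j)/(j−i) · ∏_{p+1≤i<j≤p+q} (λ_i−λ_j)/(j−i)`. -/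
def PK (p q : ℕ) (lam : ℕ → ℚ) : ℚ :=
  blockProd (Finset.Icc 1 p) lam * blockProd (Finset.Icc (p + 1) (p + q)) lam

/-- The Weyl dimension polynomial `P_{K∩L}`, a product over the five index blocks
`{1,…,k}`, `{k+1,…,p}`, `{p+1,…,2p−k}`, `{2p−k+1,…,p+q−k}`, `{p+q−k+1,…,p+q}`. -/
def PKL (p q k : ℕ) (lam : ℕ → ℚ) : ℚ :=
  blockProd (Finset.Icc 1 k) lam * blockProd (Finset.Icc (k + 1) p) lam *
    blockProd (Finset.Icc (p + 1) (2 * p - k)) lam *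
    blockProd (Finset.Icc (2 * p - k + 1) (p + q - k)) lam *
    blockProd (Finset.Icc (p + q - k + 1) (p + q)) lam

/-- The vector `e_i − e_j` in `ℚ^n` (indices written `1,…,n`). -/
def root (i j : ℕ) : ℕ → ℚ := fun t => (if t = i then (1 : ℚ) else 0) - (if t = j then 1 else 0)

/-- `σ(S) = ∑_{β ∈ S} β`, where the finite set `S` of vectors `e_i − e_j` is encoded by the
finite set of the corresponding pairs `(i, j)`. -/
def sigmaSum (S : Finset (ℕ × ℕ)) : ℕ → ℚ := fun t => ∑ ij ∈ S, root ij.1 ij.2 t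

/-- `Δ_n^+(𝔩) = {e_i − e_j : 1 ≤ i ≤ k, p+1 ≤ j ≤ 2p−k} ∪
{e_i − e_j : k+1 ≤ i ≤ p, p+q−k+1 ≤ j ≤ p+q}`, encoded by pairs of indices. -/
def DeltaNL (p q k : ℕ) : Finset (ℕ × ℕ) :=
  (Finset.Icc 1 k ×ˢ Finset.Icc (p + 1) (2 * p - k)) ∪
    (Finset.Icc (k + 1) p ×ˢ Finset.Icc (p + q - k + 1) (p + q))

/-- `Δ(𝔭_1) = {e_i − e_j : 1 ≤ i ≤ k, 2p−k+1 ≤ j ≤ p+q−k} ∪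
{e_i − e_j : 2p−k+1 ≤ i ≤ p+q−k, k+1 ≤ j ≤ p}`, encoded by pairs of indices. -/
def DeltaP1 (p q k : ℕ) : Finset (ℕ × ℕ) :=
  (Finset.Icc 1 k ×ˢ Finset.Icc (2 * p - k + 1) (p + q - k)) ∪
    (Finset.Icc (2 * p - k + 1) (p + q - k) ×ˢ Finset.Icc (k + 1) p)

/-- The special point
`λ_0 = (q, q−1, …, q−k+1, p, p−1, …, k+1 | p−k, …, 1, q−k, …, p−k+1, k, …, 1)`. -/
def lam0 (p q k : ℕ) : ℕ → ℚ := fun t =>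
  if t ≤ k then (q : ℚ) + 1 - t
  else if t ≤ p then (p : ℚ) + k + 1 - t
  else if t ≤ 2 * p - k then 2 * (p : ℚ) - k + 1 - t
  else if t ≤ p + q - k then (q : ℚ) + 2 * p - 2 * k + 1 - t
  else (p : ℚ) + q + 1 - t

/-- The alternating double sum
`∑_{A ⊆ Δ_n^+(𝔩)} ∑_{C ⊆ Δ(𝔭_1)} (−1)^{|A|+|C|} P_K(λ − σ(A) − σ(C))`. -/
def DSum (p q k : ℕ) (lam : ℕ → ℚ) : ℚ :=
  ∑ A ∈ (DeltaNL p q k).powerset, ∑ C ∈ (DeltaP1 p q k).powerset,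
    (-1 : ℚ) ^ (A.card + C.card) *
      PK p q (fun t => lam t - sigmaSum A t - sigmaSum C t)

/-- A `(k, p−k)`-shuffle of `(p, p−1, …, 1)`: a pair of strictly decreasing integer sequences
`i_1 > ⋯ > i_k` and `j_1 > ⋯ > j_{p−k}` whose underlying sets partition `{1, …, p}`. -/
def IsShuffle (p k : ℕ) (ii jj : ℕ → ℕ) : Prop :=
  (∀ a b : ℕ, 1 ≤ a → a < b → b ≤ k → ii b < ii a) ∧
  (∀ a b : ℕ, 1 ≤ a → a < b → b ≤ p - k → jj b < jj a) ∧
  ((Finset.Icc 1 k).image ii ∪ (Finset.Icc 1 (p - k)).image jj = Finset.Icc 1 p) ∧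
  Disjoint ((Finset.Icc 1 k).image ii) ((Finset.Icc 1 (p - k)).image jj)

/-- The subset `A(sh) = {α_{a,b} : 1 ≤ a ≤ k, 1 ≤ b ≤ p−k}` of `Δ_n^+(𝔩)` associated to a
shuffle, where `α_{a,b} = e_a − e_{p+b}` if `i_a < j_b` and
`α_{a,b} = e_{k+b} − e_{2p−k+a}` if `i_a > j_b` (vectors encoded by index pairs). -/
def shuffleSet (p k : ℕ) (ii jj : ℕ → ℕ) : Finset (ℕ × ℕ) :=
  (Finset.Icc 1 k ×ˢ Finset.Icc 1 (p - k)).image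
    (fun ab => if ii ab.1 < jj ab.2 then (ab.1, p + ab.2) else (k + ab.2, 2 * p - k + ab.1))

/-- A loopless digraph on `V` whose in-degrees are distinct and whose out-degrees are distinct is a
transitive tournament, ordered by out-degree. -/
theorem rel_iff_outdegree_lt {α : Type*} [DecidableEq α] (R : α → α → Prop) [DecidableRel R]
    (V : Finset α) (irr : ∀ v ∈ V, ¬ R v v)
    (hin : Set.InjOn (fun v => #{u ∈ V | R u v}) V)
    (hout : Set.InjOn (fun u => #{v ∈ V | R u v}) V) :
    ∀ u ∈ V, ∀ v ∈ V, (R u v ↔ #{w ∈ V | R v w} < #{w ∈ V | R u w}) := by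
  induction V using Finset.strongInduction with
  | H V ih =>
  intro u hu v hv
  have hsub (P : α → Prop) [DecidablePred P] (x : α) (hx : x ∈ V) (hP : ¬ P x) :
      #{y ∈ V | P y} < #V :=
    card_lt_card ((filter_ssubset).2 ⟨x, hx, hP⟩)
  have hpos : 0 < #V := card_pos.2 ⟨u, hu⟩
  obtain ⟨w, hw, hwd⟩ := surjOn_of_injOn_of_card_le (s := V) (t := range #V) _
    (fun x hx => by simpa using hsub (fun y => R y x) x hx (irr x hx)) hin (by simp)
    (show #V - 1 ∈ _ by simpa using hpos)
  obtain ⟨z, hz, hzd⟩ := surjOn_of_injOn_of_card_le (s := V) (t := range #V) _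
    (fun x hx => by simpa using hsub (fun y => R x y) x hx (irr x hx)) hout (by simp)
    (show 0 ∈ _ by simpa using hpos)
  have hw' : w ∈ V := hw
  have hall : ∀ x ∈ V, x ≠ w → R x w := by
    have : {y ∈ V | R y w} = V.erase w := by
      refine eq_of_subset_of_card_le (fun y hy => ?_) ?_
      · obtain ⟨hy, hyw⟩ := mem_filter.1 hy
        exact mem_erase.2 ⟨fun h => irr w hw' (h ▸ hyw), hy⟩
      · rw [card_erase_of_mem hw']
        exact hwd.ge
    intro x hx hxw
    have hmem : x ∈ {y ∈ V | R y w} := by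
      rw [this]
      exact mem_erase.2 ⟨hxw, hx⟩
    exact (mem_filter.1 hmem).2
  have hznone : ∀ y ∈ V, ¬ R z y := by
    simpa [filter_eq_empty_iff] using hzd
  have hzw : z = w := by
    by_contra h
    exact hznone w hw' (hall z hz h)
  subst hzw
  have hE_in : ∀ x ∈ V, #{y ∈ V.erase z | R y x} = #{y ∈ V | R y x} := by
    intro x hx
    congr 1
    ext y
    simp only [mem_filter, mem_erase]
    exact ⟨fun h => ⟨h.1.2, h.2⟩, fun h => ⟨⟨fun e => hznone x hx (e ▸ h.2), h.1⟩, h.2⟩⟩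
  have hE_out : ∀ x ∈ V.erase z, #{y ∈ V.erase z | R x y} + 1 = #{y ∈ V | R x y} := by
    intro x hx
    obtain ⟨hxz, hx⟩ := mem_erase.1 hx
    rw [filter_erase, card_erase_add_one]
    exact mem_filter.2 ⟨hz, hall x hx hxz⟩
  by_cases huz : u = z
  · subst huz
    simp only [hznone v hv, false_iff, not_lt]
    exact hzd.le.trans (Nat.zero_le _)
  by_cases hvz : v = z
  · subst hvz
    simp only [hall u hu huz, true_iff]
    refine hzd.le.trans_lt (card_pos.2 ⟨v, mem_filter.2 ⟨hv, hall u hu huz⟩⟩)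
  have huE := mem_erase.2 ⟨huz, hu⟩
  have hvE := mem_erase.2 ⟨hvz, hv⟩
  rw [← hE_out u huE, ← hE_out v hvE, Nat.add_lt_add_iff_right]
  refine ih _ (erase_ssubset hz) (fun x hx => irr x (mem_of_mem_erase hx)) ?_ ?_ u huE v hvE
  · intro x hx y hy hxy
    have hx := mem_of_mem_erase hx
    have hy := mem_of_mem_erase hy
    exact hin hx hy ((hE_in x hx).symm.trans (hxy.trans (hE_in y hy)))
  · intro x hx y hy hxy
    exact hout (mem_of_mem_erase hx) (mem_of_mem_erase hy)
      ((hE_out x hx).symm.trans ((congrArg (· + 1) hxy).trans (hE_out y hy)))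

theorem injOn_of_blockProd_ne_zero {B : Finset ℕ} {lam : ℕ → ℚ} (h : blockProd B lam ≠ 0) :
    Set.InjOn lam B := by
  have key : ∀ i ∈ B, ∀ j ∈ B, i < j → lam i ≠ lam j := by
    intro i hi j hj hij heq
    have := prod_ne_zero_iff.1 (prod_ne_zero_iff.1 h i hi) j hj
    simp [hij, heq] at this
  intro i hi j hj heq
  rcases lt_trichotomy i j with hij | hij | hij
  · exact (key i hi j hj hij heq).elim
  · exact hij
  · exact (key j hj i hi hij heq.symm).elim

theorem sigmaSum_eq_card_sub_card (S : Finset (ℕ × ℕ)) (t : ℕ) :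
    sigmaSum S t = (#{x ∈ S | x.1 = t} : ℚ) - #{x ∈ S | x.2 = t} := by
  simp [sigmaSum, root, sum_sub_distrib, eq_comm]

/-- The index in the second block `{p+1,…,2p}` attached to `u ∈ {1,…,p}`: the second block lists
the vertices `k+1,…,p` first and then `1,…,k`. -/
def partner (p k u : ℕ) : ℕ := if u ≤ k then 2 * p - k + u else p + u - k

/-- The arcs of the digraph on `{1,…,p}` defined by `A`: transitive tournaments on `{1,…,k}` and
on `{k+1,…,p}`, with the arcs between the two parts prescribed by `A`. -/
abbrev Arc (p k : ℕ) (A : Finset (ℕ × ℕ)) (u v : ℕ) : Prop :=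
  (v, partner p k u) ∈ A ∨ ((u ≤ k ↔ v ≤ k) ∧ u < v)

section Degrees

variable {p k : ℕ} {A : Finset (ℕ × ℕ)}

theorem mem_DeltaNL_self (hk : k ≤ p) {x : ℕ × ℕ} : x ∈ DeltaNL p p k ↔
    (1 ≤ x.1 ∧ x.1 ≤ k ∧ p + 1 ≤ x.2 ∧ x.2 ≤ 2 * p - k) ∨
      (k + 1 ≤ x.1 ∧ x.1 ≤ p ∧ 2 * p - k + 1 ≤ x.2 ∧ x.2 ≤ 2 * p) := by
  simp only [DeltaNL, mem_union, mem_product, mem_Icc]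
  omega

theorem not_same_side (hk : k ≤ p) (hA : A ⊆ DeltaNL p p k) {u v : ℕ} (hu : u ∈ Icc 1 p)
    (h : (v, partner p k u) ∈ A) : ¬ (u ≤ k ↔ v ≤ k) := by
  have := (mem_DeltaNL_self hk).1 (hA h)
  rw [mem_Icc] at hu
  simp only [partner] at this
  split_ifs at this <;> omega

theorem indegree_eq (hk : k ≤ p) (hA : A ⊆ DeltaNL p p k) {v : ℕ} (hv : v ∈ Icc 1 p) :
    #{u ∈ Icc 1 p | Arc p k A u v} =
      #{x ∈ A | x.1 = v} + (if v ≤ k then v - 1 else v - k - 1) := by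
  unfold Arc
  rw [filter_or, card_union_of_disjoint]
  · congr 1
    · refine card_bij (fun u _ => (v, partner p k u)) ?_ ?_ ?_
      · intro u hu
        simpa using (mem_filter.1 hu).2
      · intro u hu u' hu' h
        simp only [mem_filter, mem_Icc] at hu hu'
        simp only [Prod.mk.injEq, true_and, partner] at h
        split_ifs at h <;> omega
      · rintro ⟨x, y⟩ hx
        obtain ⟨hxA, hxv⟩ := mem_filter.1 hx
        obtain rfl : x = v := hxv
        have := (mem_DeltaNL_self hk).1 (hA hxA)
        simp only at this
        obtain ⟨u, hu, hu1, hu2⟩ : ∃ u, partner p k u = y ∧ 1 ≤ u ∧ u ≤ p := by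
          by_cases hy : y ≤ 2 * p - k
          · exact ⟨y - p + k, by unfold partner; split_ifs <;> omega, by omega, by omega⟩
          · exact ⟨y - (2 * p - k), by unfold partner; split_ifs <;> omega, by omega, by omega⟩
        exact ⟨u, by simp [hu, hxA, hu1, hu2], by simp [hu]⟩
    · rw [mem_Icc] at hv
      split_ifs with h
      · rw [← Nat.card_Ico]
        congr 1
        ext u
        simp only [mem_filter, mem_Icc, mem_Ico]
        omega
      · rw [Nat.sub_sub, ← Nat.card_Ico]
        congr 1
        ext u
        simp only [mem_filter, mem_Icc, mem_Ico]
        omega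
  · rw [disjoint_filter]
    exact fun u hu h h' => not_same_side hk hA hu h h'.1

theorem outdegree_eq (hk : k ≤ p) (hA : A ⊆ DeltaNL p p k) {u : ℕ} (hu : u ∈ Icc 1 p) :
    #{v ∈ Icc 1 p | Arc p k A u v} =
      #{x ∈ A | x.2 = partner p k u} + (if u ≤ k then k - u else p - u) := by
  unfold Arc
  rw [filter_or, card_union_of_disjoint]
  · congr 1
    · refine card_bij (fun v _ => (v, partner p k u)) ?_ ?_ ?_
      · intro v hv
        simpa using (mem_filter.1 hv).2
      · intro v _ v' _ h
        exact congrArg Prod.fst h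
      · rintro ⟨x, y⟩ hx
        obtain ⟨hx, rfl⟩ := mem_filter.1 hx
        have := (mem_DeltaNL_self hk).1 (hA hx)
        simp only at this hx
        refine ⟨x, ?_, rfl⟩
        simp only [mem_filter, mem_Icc, hx, and_true]
        omega
    · rw [mem_Icc] at hu
      split_ifs with h
      · rw [← Nat.card_Ioc]
        congr 1
        ext v
        simp only [mem_filter, mem_Icc, mem_Ioc]
        omega
      · rw [← Nat.card_Ioc]
        congr 1
        ext v
        simp only [mem_filter, mem_Icc, mem_Ioc]
        omega
  · rw [disjoint_filter]
    exact fun v _ h h' => not_same_side hk hA hu h h'.1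

theorem indegree_eq_sub (hk : k ≤ p) (hA : A ⊆ DeltaNL p p k) {v : ℕ} (hv : v ∈ Icc 1 p) :
    lam0 p p k v - sigmaSum A v = p - #{u ∈ Icc 1 p | Arc p k A u v} := by
  have h0 : #{x ∈ A | x.2 = v} = 0 := by
    rw [card_eq_zero, filter_eq_empty_iff]
    intro x hx h
    have := (mem_DeltaNL_self hk).1 (hA hx)
    rw [mem_Icc] at hv
    omega
  rw [indegree_eq hk hA hv, sigmaSum_eq_card_sub_card, h0, lam0]
  rw [mem_Icc] at hv
  split_ifs with h
  · push_cast [hv.1]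
    ring
  · rw [Nat.sub_sub]
    push_cast [show k + 1 ≤ v by omega]
    ring
  all_goals omega

theorem outdegree_eq_sub (hk : k ≤ p) (hA : A ⊆ DeltaNL p p k) {u : ℕ} (hu : u ∈ Icc 1 p) :
    lam0 p p k (partner p k u) - sigmaSum A (partner p k u) =
      #{v ∈ Icc 1 p | Arc p k A u v} + 1 := by
  have hu' := mem_Icc.1 hu
  have h0 : #{x ∈ A | x.1 = partner p k u} = 0 := by
    rw [card_eq_zero, filter_eq_empty_iff]
    intro x hx h
    have := (mem_DeltaNL_self hk).1 (hA hx)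
    unfold partner at h
    split_ifs at h <;> omega
  have hlam : lam0 p p k (partner p k u) = ((if u ≤ k then k - u else p - u : ℕ) : ℚ) + 1 := by
    by_cases h : u ≤ k
    · rw [partner, if_pos h, if_pos h, lam0, if_neg (by omega), if_neg (by omega),
        if_neg (by omega), if_neg (by omega)]
      push_cast [h, show k ≤ 2 * p by omega]
      ring
    · rw [partner, if_neg h, if_neg h, lam0, if_neg (by omega), if_neg (by omega),
        if_pos (by omega)]
      push_cast [hu'.2, show k ≤ p + u by omega]
      ring
  rw [outdegree_eq hk hA hu, sigmaSum_eq_card_sub_card, h0, hlam]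
  push_cast
  ring

end Degrees

/-- Assume `p = q`. If `A ⊆ Δ_n^+(𝔩)` satisfies `P_K(λ_0 − σ(A)) ≠ 0`, then there is a
`(k, p−k)`-shuffle `sh` of `(p, p−1, …, 1)` with `A = A(sh)`. -/
theorem stmt_6 (p k : ℕ) (hp : 1 ≤ p) (hk : k ≤ p)
    (A : Finset (ℕ × ℕ)) (hA : A ⊆ DeltaNL p p k)
    (hne : PK p p (fun t => lam0 p p k t - sigmaSum A t) ≠ 0) :
    ∃ ii jj : ℕ → ℕ, IsShuffle p k ii jj ∧ A = shuffleSet p k ii jj := by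
  have hPK := mul_ne_zero_iff.1 hne
  have hin : Set.InjOn (fun v => #{u ∈ Icc 1 p | Arc p k A u v}) (Icc 1 p : Finset ℕ) := by
    intro u hu v hv h
    refine injOn_of_blockProd_ne_zero hPK.1 hu hv ?_
    simp only [indegree_eq_sub hk hA hu, indegree_eq_sub hk hA hv]
    exact congrArg (fun d : ℕ => (p : ℚ) - d) h
  have hpartner : ∀ u ∈ Icc 1 p, partner p k u ∈ Icc (p + 1) (p + p) := by
    intro u hu
    rw [mem_Icc] at hu ⊢
    unfold partner
    split_ifs <;> omega
  have hout : Set.InjOn (fun u => #{v ∈ Icc 1 p | Arc p k A u v}) (Icc 1 p : Finset ℕ) := by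
    intro u hu v hv h
    have : partner p k u = partner p k v := by
      refine injOn_of_blockProd_ne_zero hPK.2 (hpartner u hu) (hpartner v hv) ?_
      simp only [outdegree_eq_sub hk hA hu, outdegree_eq_sub hk hA hv]
      exact congrArg (fun d : ℕ => (d : ℚ) + 1) h
    have hu := mem_Icc.1 hu
    have hv := mem_Icc.1 hv
    unfold partner at this
    split_ifs at this <;> omega
  have hirr : ∀ v ∈ Icc 1 p, ¬ Arc p k A v v := by
    rintro v hv (h | h)
    · exact not_same_side hk hA hv h Iff.rfl
    · exact lt_irrefl v h.2
  have hrel := rel_iff_outdegree_lt (Arc p k A) (Icc 1 p) hirr hin hout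
  have hle : ∀ u ∈ Icc 1 p, #{v ∈ Icc 1 p | Arc p k A u v} + 1 ≤ p := by
    intro u hu
    have := card_lt_card ((filter_ssubset (p := fun v => Arc p k A u v)).2 ⟨u, hu, hirr u hu⟩)
    simpa using this
  set f : ℕ → ℕ := fun u => #{v ∈ Icc 1 p | Arc p k A u v}
  have hanti : ∀ u v, 1 ≤ u → u < v → v ≤ p → (u ≤ k ↔ v ≤ k) → f v < f u :=
    fun u v h1 h2 h3 h4 =>
      (hrel u (mem_Icc.2 ⟨h1, by omega⟩) v (mem_Icc.2 ⟨by omega, h3⟩)).1 (.inr ⟨h4, h2⟩)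
  have hX : ∀ a b, 1 ≤ a → a ≤ k → 1 ≤ b → b ≤ p - k →
      ((a, p + b) ∈ A ↔ f a < f (k + b)) := by
    intro a b h1 h2 h3 h4
    rw [← hrel (k + b) (mem_Icc.2 ⟨by omega, by omega⟩) a (mem_Icc.2 ⟨h1, by omega⟩), Arc, partner,
      if_neg (by omega), show p + (k + b) - k = p + b by omega]
    exact ⟨.inl, fun h => h.resolve_right (by omega)⟩
  have hY : ∀ a b, 1 ≤ a → a ≤ k → 1 ≤ b → b ≤ p - k →
      ((k + b, 2 * p - k + a) ∈ A ↔ f (k + b) < f a) := by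
    intro a b h1 h2 h3 h4
    rw [← hrel a (mem_Icc.2 ⟨h1, by omega⟩) (k + b) (mem_Icc.2 ⟨by omega, by omega⟩), Arc, partner,
      if_pos (by omega)]
    exact ⟨.inl, fun h => h.resolve_right (by omega)⟩
  have hne : ∀ a b, 1 ≤ a → a ≤ k → 1 ≤ b → b ≤ p - k → f a ≠ f (k + b) := by
    intro a b h1 h2 h3 h4 h
    have := hout (mem_coe.2 (mem_Icc.2 ⟨h1, by omega⟩))
      (mem_coe.2 (mem_Icc.2 ⟨by omega, by omega⟩)) h
    omega
  refine ⟨fun a => f a + 1, fun b => f (k + b) + 1, ⟨?_, ?_, ?_, ?_⟩, ?_⟩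
  · intro a b h1 h2 h3
    exact Nat.succ_lt_succ (hanti a b h1 h2 (by omega) (by omega))
  · intro a b h1 h2 h3
    exact Nat.succ_lt_succ (hanti (k + a) (k + b) (by omega) (by omega) (by omega) (by omega))
  · have himage : (Icc 1 p).image (fun u => f u + 1) = Icc 1 p := by
      refine eq_of_subset_of_card_le (image_subset_iff.2 fun u hu => ?_) ?_
      · exact mem_Icc.2 ⟨by omega, hle u hu⟩
      · rw [card_image_of_injOn fun u hu v hv h => hout hu hv (Nat.succ_injective h)]
    rw [← himage]
    ext y
    simp only [mem_union, mem_image, mem_Icc]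
    constructor
    · rintro (⟨a, ha, rfl⟩ | ⟨b, hb, rfl⟩)
      · exact ⟨a, by omega, rfl⟩
      · exact ⟨k + b, by omega, rfl⟩
    · rintro ⟨u, hu, rfl⟩
      by_cases h : u ≤ k
      · exact .inl ⟨u, by omega, rfl⟩
      · exact .inr ⟨u - k, by omega, by rw [show k + (u - k) = u by omega]⟩
  · rw [disjoint_left]
    intro y hy hy'
    simp only [mem_image, mem_Icc] at hy hy'
    obtain ⟨a, ha, rfl⟩ := hy
    obtain ⟨b, hb, h⟩ := hy'
    exact hne a b ha.1 ha.2 hb.1 hb.2 (Nat.succ_injective h.symm)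
  · ext ⟨x, y⟩
    simp only [shuffleSet, mem_image, mem_product, mem_Icc, Prod.exists, Nat.add_lt_add_iff_right]
    constructor
    · intro h
      rcases (mem_DeltaNL_self hk).1 (hA h) with hx | hx <;> simp only at hx
      · obtain ⟨b, rfl⟩ : ∃ b, y = p + b := ⟨y - p, by omega⟩
        refine ⟨x, b, by omega, ?_⟩
        rw [if_pos ((hX x b (by omega) (by omega) (by omega) (by omega)).1 h)]
      · obtain ⟨b, rfl⟩ : ∃ b, x = k + b := ⟨x - k, by omega⟩
        obtain ⟨a, rfl⟩ : ∃ a, y = 2 * p - k + a := ⟨y - (2 * p - k), by omega⟩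
        refine ⟨a, b, by omega, ?_⟩
        rw [if_neg ((hY a b (by omega) (by omega) (by omega) (by omega)).1 h).not_gt]
    · rintro ⟨a, b, ⟨ha, hb⟩, h⟩
      split_ifs at h with hlt
      · rw [← h]
        exact (hX a b ha.1 ha.2 hb.1 hb.2).2 hlt
      · rw [← h]
        exact (hY a b ha.1 ha.2 hb.1 hb.2).2
          (lt_of_le_of_ne (not_lt.1 hlt) (hne a b ha.1 ha.2 hb.1 hb.2).symm)
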